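/- arXiv:2404.18438 — 3 statements merged into one kernel-verified Lean document; each statement's English description precedes it below -/
import Mathlib

section
/- Let q ≥ 5 be an odd prime power and m = 2^e·ℓ, where ℓ ≥ 3 is odd and e ≥ 1. Let N = q^m - 1 and h = (m + 2^e)/2. Then for every integer i with -(q-2) ≤ i ≤ q^{h - 2^e}, the integer (q^{h - 2^e + 1} + (q-1)·q^{h - 2^e} + (q^h + 1)·i) mod N is odd and its Hamming weight (in base q) is even; that is, it belongs to T_{(0,n)}. -/
/-- The Hamming weight of a natural number in base `q`:
the number of nonzero base-`q` digits. -/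
def hwt (q i : ℕ) : ℕ := ((Nat.digits q i).filter (· ≠ 0)).length

theorem hwt_of_pos_of_lt {q r : ℕ} (hr : 0 < r) (hrq : r < q) : hwt q r = 1 := by
  simp [hwt, Nat.digits_of_lt q r hr.ne' hrq, hr.ne']

theorem hwt_add_mul {q r : ℕ} (hq : 1 < q) (hr : r < q) (n : ℕ) :
    hwt q (r + q * n) = hwt q r + hwt q n := by
  rcases Nat.eq_zero_or_pos n with rfl | hn
  · simp [hwt]
  · rcases Nat.eq_zero_or_pos r with rfl | hr0
    · simp [hwt, Nat.digits_base_mul hq hn]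
    · rw [hwt_of_pos_of_lt hr0 hr, hwt, Nat.digits_add q hq r n hr (Or.inr hn.ne')]
      simp [hwt, hr0.ne', add_comm]

theorem hwt_add_pow_mul {q : ℕ} (hq : 1 < q) (k : ℕ) {u : ℕ} (hu : u < q ^ k) (v : ℕ) :
    hwt q (u + q ^ k * v) = hwt q u + hwt q v := by
  induction k generalizing u with
  | zero =>
    obtain rfl : u = 0 := by simpa using hu
    simp [hwt]
  | succ k ih =>
    have hmod : u % q < q := Nat.mod_lt _ (by omega)
    have hdiv : u / q < q ^ k := Nat.div_lt_of_lt_mul (by rwa [pow_succ'] at hu)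
    have hsplit : u + q ^ (k + 1) * v = u % q + q * (u / q + q ^ k * v) := by
      conv_lhs => rw [← Nat.mod_add_div u q]
      ring
    have hu' := hwt_add_mul hq hmod (u / q)
    rw [Nat.mod_add_div] at hu'
    rw [hsplit, hwt_add_mul hq hmod, ih hdiv, hu', add_assoc]

theorem hwt_pow_sub_one {q : ℕ} (hq : 1 < q) (a : ℕ) : hwt q (q ^ a - 1) = a := by
  induction a with
  | zero => simp [hwt]
  | succ a ih =>
    have hpos : 0 < q ^ a := by positivity
    have hsplit : q ^ (a + 1) - 1 = (q - 1) + q * (q ^ a - 1) := by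
      obtain ⟨c, hc⟩ := Nat.exists_eq_add_of_le hpos
      rw [pow_succ', hc]
      simp only [Nat.succ_eq_add_one, zero_add, mul_add, mul_one, Nat.add_sub_cancel_left]
      omega
    rw [hsplit, hwt_add_mul hq (by omega), ih, hwt_of_pos_of_lt (by omega) (by omega), add_comm]

theorem hwt_pow_sub {q a j : ℕ} (ha : 1 ≤ a) (hj : 1 ≤ j) (hjq : j < q) :
    hwt q (q ^ a - j) = a := by
  obtain ⟨b, rfl⟩ := Nat.exists_eq_add_of_le' ha
  have hpos : 0 < q ^ b := pow_pos (by omega) b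
  have hsplit : q ^ (b + 1) - j = (q - j) + q * (q ^ b - 1) := by
    obtain ⟨c, hc⟩ := Nat.exists_eq_add_of_le hpos
    rw [pow_succ', hc]
    simp only [Nat.succ_eq_add_one, zero_add, mul_add, mul_one, Nat.add_sub_cancel_left]
    omega
  rw [hsplit, hwt_add_mul (by omega) (by omega), hwt_pow_sub_one (by omega),
    hwt_of_pos_of_lt (by omega) (by omega), add_comm]

/-- The weight of a number made of a block `u` of `a` digits, then the digits `s` and `1`,
then `k` zeros, then a number `v`. -/
theorem hwt_blocks {q a k s u : ℕ} (hq : 1 < q) (hs : 0 < s) (hsq : s < q)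
    (hu : u < q ^ a) (v : ℕ) :
    hwt q (u + q ^ a * (s + q * (1 + q * (q ^ k * v)))) = hwt q u + 2 + hwt q v := by
  have hv := hwt_add_pow_mul hq k (u := 0) (by positivity) v
  rw [zero_add] at hv
  rw [hwt_add_pow_mul hq a hu, hwt_add_mul hq hsq, hwt_add_mul hq hq, hv,
    hwt_of_pos_of_lt hs hsq, hwt_of_pos_of_lt one_pos hq]
  simp [hwt]
  ring

/-- Let `q ≥ 5` be an odd prime power and `m = 2^e·ℓ` with `ℓ ≥ 3` odd and
`e ≥ 1`. Let `N = q^m - 1` and `h = (m + 2^e)/2`. Then for every integer `i`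
with `-(q-2) ≤ i ≤ q^{h - 2^e}`, the integer
`(q^{h - 2^e + 1} + (q-1)·q^{h - 2^e} + (q^h + 1)·i) mod N` is odd, lies in
`{1, …, N-1}`, and its Hamming weight in base `q` is even; that is, it
belongs to `T_{(0,n)}`. -/
theorem stmt8 (q m e l : ℕ) (hq : 5 ≤ q) (hodd : Odd q) (hpp : IsPrimePow q)
    (hl : 3 ≤ l) (hlo : Odd l) (he : 1 ≤ e) (hm : m = 2 ^ e * l)
    (N : ℤ) (hN : N = (q : ℤ) ^ m - 1) (h : ℕ) (hh : h = (m + 2 ^ e) / 2)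
    (i : ℤ) (hi1 : -((q : ℤ) - 2) ≤ i) (hi2 : i ≤ (q : ℤ) ^ (h - 2 ^ e)) :
    ∀ x : ℤ, x = ((q : ℤ) ^ (h - 2 ^ e + 1) + ((q : ℤ) - 1) * (q : ℤ) ^ (h - 2 ^ e)
        + ((q : ℤ) ^ h + 1) * i) % N →
      Odd x ∧ 1 ≤ x ∧ x ≤ N - 1 ∧ Even (hwt q x.toNat) := by
  intro x hx
  obtain ⟨a, d, hd, ha, had, ham, hda⟩ : ∃ a d : ℕ, 2 ≤ d ∧ 1 ≤ a ∧ h = a + d ∧ m = a + h ∧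
      h - 2 ^ e = a := by
    obtain ⟨k, rfl⟩ := hlo
    obtain ⟨f, rfl⟩ := Nat.exists_eq_add_of_le' he
    have hm' : m = 4 * (2 ^ f * k) + 2 * 2 ^ f := by rw [hm]; ring
    have h2 : 2 ^ (f + 1) = 2 * 2 ^ f := by ring
    have hf : 0 < 2 ^ f := by positivity
    have hfk : 0 < 2 ^ f * k := Nat.mul_pos hf (by omega)
    exact ⟨2 * (2 ^ f * k), 2 ^ (f + 1), by omega, by omega, by omega, by omega, by omega⟩
  rw [hda] at hx hi2
  have hq1 : 1 < q := by omega
  have hqZ : (5 : ℤ) ≤ q := by exact_mod_cast hq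
  have hoddZ : Odd (q : ℤ) := by exact_mod_cast hodd
  have hNeven : Even N := by
    rw [hN]; exact hoddZ.pow.sub_odd odd_one
  have hqa : (q : ℤ) ≤ (q : ℤ) ^ a := le_self_pow₀ (by omega) (by omega)
  have hqd : (q : ℤ) ^ 2 ≤ (q : ℤ) ^ d := pow_le_pow_right₀ (by omega) hd
  have hqh : (q : ℤ) ^ h = q ^ a * q ^ d := by rw [had, pow_add]
  have hqm : (q : ℤ) ^ m = q ^ a * q ^ h := by rw [ham, pow_add]
  have hNpos : 0 < N := by
    rw [hN, hqm, hqh]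
    have hA : (0 : ℤ) < q ^ a := by positivity
    have hD : (0 : ℤ) < q ^ d := by positivity
    nlinarith [mul_pos hA hD]
  have hxodd : Odd x := by
    have hy : Odd ((q : ℤ) ^ (a + 1) + ((q : ℤ) - 1) * (q : ℤ) ^ a + ((q : ℤ) ^ h + 1) * i) :=
      (hoddZ.pow.add_even ((hoddZ.sub_odd odd_one).mul_right _)).add_even
        ((hoddZ.pow.add_odd odd_one).mul_right _)
    rw [hx, Int.emod_def]
    exact hy.sub_even (hNeven.mul_right _)
  have hx0 : 0 ≤ x := hx ▸ Int.emod_nonneg _ hNpos.ne'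
  have hxN : x < N := hx ▸ Int.emod_lt_of_pos _ hNpos
  refine ⟨hxodd, ?_, by omega, ?_⟩
  · rcases hxodd with ⟨t, ht⟩
    omega
  have key : ∀ (y : ℕ) (t : ℤ), (y : ℤ) ≤ N → (y : ℤ) = (q : ℤ) ^ (a + 1) + ((q : ℤ) - 1) * (q : ℤ) ^ a
      + ((q : ℤ) ^ h + 1) * i + N * t → x.toNat = y := by
    intro y t hy hyt
    have hxy : x = (y : ℤ) % N := by
      rw [hx, hyt, Int.add_mul_emod_self_left]
    have hne : (y : ℤ) ≠ N := by
      intro hE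
      rw [hE, Int.emod_self] at hxy
      rw [hxy] at hxodd
      exact absurd hxodd (by decide)
    rw [Int.emod_eq_of_lt (by omega) (by omega)] at hxy
    omega
  have hd2 : (q : ℤ) ^ d = q * (q * q ^ (d - 2)) := by
    obtain ⟨c, rfl⟩ := Nat.exists_eq_add_of_le' hd
    rw [Nat.add_sub_cancel]; ring
  have bound : ∀ u s v : ℕ, u < q ^ a → s < q → v < q ^ a →
      ((u + q ^ a * (s + q * (1 + q * (q ^ (d - 2) * v))) : ℕ) : ℤ) ≤ N := by
    intro u s v hu hs hv
    zify at hu hs hv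
    push_cast
    have hA : (0 : ℤ) < q ^ a := by positivity
    have h1 : (q : ℤ) ^ a * (s + q + 1) ≤ q ^ a * q ^ d :=
      mul_le_mul_of_nonneg_left (by nlinarith) hA.le
    have h2 : (q : ℤ) ^ a * q ^ d * (v + 1) ≤ q ^ a * q ^ d * q ^ a :=
      mul_le_mul_of_nonneg_left (by omega) (by positivity)
    have h3 : (u : ℤ) + q ^ a * (s + q * (1 + q * (q ^ (d - 2) * v)))
        = u + q ^ a * (s + q) + q ^ a * q ^ d * v := by rw [hd2]; ring
    rw [h3, hN, hqm, hqh]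
    linarith
  rcases lt_or_ge i 0 with hneg | hnn
  · obtain ⟨j, hj⟩ := Int.eq_ofNat_of_zero_le (show 0 ≤ -i by omega)
    have hjq : j + 2 ≤ q := by omega
    have hj1 : 1 ≤ j := by omega
    have hqaN : q ≤ q ^ a := by exact_mod_cast hqa
    rw [key (q ^ a - (j + 1) + q ^ a * (q - 2 + q * (1 + q * (q ^ (d - 2) * (q ^ a - j))))) 1
      (bound _ _ _ (by omega) (by omega) (by omega)) ?_,
      hwt_blocks hq1 (by omega) (by omega) (by omega), hwt_pow_sub ha (by omega) (by omega),
      hwt_pow_sub ha hj1 (by omega)]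
    · exact ⟨a + 1, by ring⟩
    · obtain rfl : i = -j := by omega
      push_cast [show j + 1 ≤ q ^ a by omega, show j ≤ q ^ a by omega, show 2 ≤ q by omega]
      rw [hN, hqm, hqh, hd2]
      ring
  · rcases hi2.lt_or_eq with hlt | rfl
    · lift i to ℕ using hnn
      have hlt' : i < q ^ a := by exact_mod_cast hlt
      rw [key (i + q ^ a * (q - 1 + q * (1 + q * (q ^ (d - 2) * i)))) 0
        (bound _ _ _ hlt' (by omega) hlt') ?_,
        hwt_blocks hq1 (by omega) (by omega) hlt']
      · exact ⟨hwt q i + 1, by ring⟩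
      · push_cast [show 1 ≤ q by omega]
        rw [hqh, hd2]
        ring
    · have hy : hwt q (1 + q ^ (a + 1) * 2) = 2 := by
        rw [hwt_add_pow_mul hq1 _ (Nat.one_lt_pow (by omega) hq1),
          hwt_of_pos_of_lt one_pos hq1, hwt_of_pos_of_lt two_pos (by omega)]
      rw [key (1 + q ^ (a + 1) * 2) (-1) ?_ ?_, hy]
      · exact even_two
      · push_cast
        rw [hN, hqm, hqh, pow_succ]
        have hA : (0 : ℤ) < q ^ a := by positivity
        have h1 : (q : ℤ) ^ a * q ^ 2 ≤ q ^ a * q ^ d := mul_le_mul_of_nonneg_left hqd hA.le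
        have h2 : (q : ℤ) ^ a * (q ^ a * q ^ d) ≥ 5 * (q ^ a * q ^ d) :=
          mul_le_mul_of_nonneg_right (by omega) (by positivity)
        have h3 : (q : ℤ) ^ a * q * 5 ≤ q ^ a * q * q :=
          mul_le_mul_of_nonneg_left hqZ (by positivity)
        have h4 : (1 : ℤ) ≤ q ^ a * q := by nlinarith
        nlinarith
      · push_cast
        rw [hN, hqm]
        ring
end

section
/- Let q = 3, let m ≥ 6 be an integer with m ≡ 2 (mod 4), let N = 3^m - 1 and h = (m+2)/2. Then for every integer i with -1 ≤ i ≤ 3^{h-2}, the integer (3^{h-1} + (3^h + 1)·i) mod N is odd and its Hamming weight (in base 3) is odd; that is, it belongs to T_{(1,n)}. -/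
theorem hwt_add_mul_s9 {q : ℕ} (hq : 1 < q) {d : ℕ} (hd : d < q) (b : ℕ) :
    hwt q (d + q * b) = (if d = 0 then 0 else 1) + hwt q b := by
  rcases Nat.eq_zero_or_pos (d + q * b) with h0 | h0
  · have hd0 : d = 0 := by omega
    have hb0 : b = 0 := by
      rcases Nat.mul_eq_zero.mp (show q * b = 0 by omega) with h | h <;> omega
    simp [hd0, hb0, hwt]
  · by_cases hd0 : d = 0
    · have hb0 : b ≠ 0 := by
        rintro rfl
        simp [hd0] at h0
      rw [hwt, Nat.digits_add q hq d b hd (Or.inr hb0)]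
      simp [hd0, hwt]
    · rw [hwt, Nat.digits_add q hq d b hd (Or.inl hd0)]
      simp [hd0, hwt, add_comm]

theorem hwt_zero (q : ℕ) : hwt q 0 = 0 := by simp [hwt]

/-- The Hamming weight is additive over a splitting of the digit string. -/
theorem hwt_add_pow_mul_s9 {q : ℕ} (hq : 1 < q) (n a b : ℕ) (ha : a < q ^ n) :
    hwt q (a + q ^ n * b) = hwt q a + hwt q b := by
  induction n generalizing a with
  | zero =>
    obtain rfl : a = 0 := by simpa using ha
    simp [hwt_zero]
  | succ n ih =>
    have hmod : a % q < q := Nat.mod_lt _ (by omega)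
    have hdiv : a / q < q ^ n := Nat.div_lt_of_lt_mul (by rwa [pow_succ'] at ha)
    have hsplit : a + q ^ (n + 1) * b = a % q + q * (a / q + q ^ n * b) := by
      conv_lhs => rw [← Nat.mod_add_div a q]
      ring
    rw [hsplit, hwt_add_mul_s9 hq hmod, ih _ hdiv, ← add_assoc, ← hwt_add_mul_s9 hq hmod,
      Nat.mod_add_div]

theorem hwt_three_of_succ_eq_pow (n a : ℕ) (ha : a + 1 = 3 ^ n) : hwt 3 a = n := by
  induction n generalizing a with
  | zero =>
    obtain rfl : a = 0 := by simpa using ha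
    exact hwt_zero 3
  | succ n ih =>
    obtain ⟨b, hb⟩ := Nat.exists_eq_add_one.mpr (show 0 < 3 ^ n by positivity)
    obtain rfl : a = 2 + 3 * b := by rw [pow_succ] at ha; omega
    rw [hwt_add_mul_s9 (by norm_num) (by norm_num), ih b hb.symm]
    simp [add_comm]

/-- Let `q = 3`, `m ≥ 6` with `m ≡ 2 (mod 4)`, `N = 3^m - 1` and
`h = (m+2)/2`. Then for every integer `i` with `-1 ≤ i ≤ 3^{h-2}`, the
integer `(3^{h-1} + (3^h + 1)·i) mod N` is odd, lies in `{1, …, N-1}`, and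
its Hamming weight in base `3` is odd; that is, it belongs to `T_{(1,n)}`. -/
theorem stmt9 (m : ℕ) (hm : 6 ≤ m) (hm4 : m % 4 = 2)
    (N : ℤ) (hN : N = (3 : ℤ) ^ m - 1) (h : ℕ) (hh : h = (m + 2) / 2)
    (i : ℤ) (hi1 : -1 ≤ i) (hi2 : i ≤ (3 : ℤ) ^ (h - 2)) :
    ∀ x : ℤ, x = ((3 : ℤ) ^ (h - 1) + ((3 : ℤ) ^ h + 1) * i) % N →
      Odd x ∧ 1 ≤ x ∧ x ≤ N - 1 ∧ Odd (hwt 3 x.toNat) := by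
  obtain ⟨n, rfl⟩ : ∃ n, h = n + 2 := ⟨h - 2, by omega⟩
  obtain rfl : m = 2 * n + 2 := by omega
  have hn : 2 ≤ n := by omega
  rintro x hx
  simp only [Nat.add_sub_cancel, show n + 2 - 1 = n + 1 by omega] at hx hi2
  have hpow : (9 : ℕ) ≤ 3 ^ n := Nat.pow_le_pow_right (n := 3) (by norm_num) hn
  obtain ⟨p, hp⟩ : ∃ p : ℕ, p = 3 ^ n := ⟨_, rfl⟩
  have hpZ : (3 : ℤ) ^ n = p := by rw [hp]; push_cast; rfl
  have hp9 : 9 ≤ p := hp ▸ hpow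
  have hpodd : p % 2 = 1 := by
    rw [← Nat.odd_iff, hp]
    exact Odd.pow (by decide)
  have hN' : N = 9 * (p : ℤ) * p - 1 := by
    rw [hN, ← hpZ]
    ring
  have hx' : x = (3 * (p : ℤ) + (9 * p + 1) * i) % N := by
    rw [hx, ← hpZ]
    ring_nf
  rw [hpZ] at hi2
  have hNpos : 9 * (p : ℤ) * 9 - 1 ≤ N := by
    rw [hN']
    nlinarith
  have key : ∀ y : ℕ, ∀ c : ℤ, 3 * (p : ℤ) + (9 * p + 1) * i = y + N * c →
      (y : ℤ) ≤ N - 1 → Odd y → Odd (hwt 3 y) →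
      Odd x ∧ 1 ≤ x ∧ x ≤ N - 1 ∧ Odd (hwt 3 x.toNat) := by
    intro y c hc hy hyo hw
    have hxy : x = y := by
      rw [hx', hc, Int.add_mul_emod_self_left]
      exact Int.emod_eq_of_lt (by positivity) (by omega)
    subst hxy
    have := hyo.pos
    exact ⟨by exact_mod_cast hyo, by omega, hy, by simpa using hw⟩
  rcases lt_or_ge i 0 with hi | hi
  · obtain rfl : i = -1 := by omega
    obtain ⟨r, rfl⟩ : ∃ r, p = r + 1 := ⟨p - 1, by omega⟩
    have hr : hwt 3 r = n := hwt_three_of_succ_eq_pow n r hp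
    refine key (1 + 3 * r + 3 ^ (n + 2) * r) (-1) ?_ ?_ ?_ ?_
    · rw [hN']
      push_cast
      rw [pow_add, hpZ]
      push_cast
      ring
    · rw [hN']
      push_cast
      rw [pow_add, hpZ]
      push_cast
      nlinarith
    · have hr2 : Even r := by rw [Nat.even_iff]; omega
      exact (odd_one.add_even (hr2.mul_left _)).add_even (hr2.mul_left _)
    · rw [hwt_add_pow_mul_s9 (by norm_num) _ _ _ (by rw [pow_add, ← hp]; omega),
        hwt_add_mul_s9 (by norm_num) (by norm_num), hr]
      exact ⟨n, by simp; ring⟩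
  lift i to ℕ using hi with j
  rcases Nat.lt_or_ge j p with hj | hj
  · refine key (j + 3 ^ n * 3 + 3 ^ (n + 2) * j) 0 ?_ ?_ ?_ ?_
    · push_cast
      rw [pow_add, hpZ]
      ring
    · rw [hN']
      push_cast
      rw [pow_add, hpZ]
      have : (j : ℤ) + 1 ≤ p := by exact_mod_cast hj
      nlinarith
    · rw [pow_add, ← hp, Nat.odd_iff]
      have : j + p * 3 + p * 3 ^ 2 * j = j + 3 * p + 9 * (p * j) := by ring
      have : p * j % 2 = j % 2 := by rw [Nat.mul_mod, hpodd]; simp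
      omega
    · rw [hwt_add_pow_mul_s9 (by norm_num) _ _ _ (by rw [pow_add, ← hp]; omega),
        hwt_add_pow_mul_s9 (by norm_num) _ _ _ (hp ▸ hj), show hwt 3 3 = 1 by simp [hwt]]
      exact ⟨hwt 3 j, by ring⟩
  · obtain rfl : j = p := by omega
    refine key (1 + 3 ^ n * 4) 1 ?_ ?_ ?_ ?_
    · rw [hN']
      push_cast
      rw [hpZ]
      ring
    · push_cast
      rw [hpZ]
      omega
    · rw [← hp, Nat.odd_iff]
      omega
    · rw [hwt_add_pow_mul_s9 (by norm_num) _ _ _ (by omega), show hwt 3 1 = 1 by simp [hwt],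
        show hwt 3 4 = 2 by simp [hwt]]
      decide
end

section
/- Let q ≥ 3 be a prime power and m ≥ 6 with m ≡ 2 (mod 4). Then: (1) for every 0 ≤ ℓ ≤ (m-6)/2 and every 0 ≤ i ≤ 2q^ℓ - 1, wt_q(2q^ℓ - 1 + (q^{(m+4)/2} - 1)·i) = 1 + (q-1)ℓ; (2) for ℓ = (m-4)/2 and every 1 ≤ i ≤ q^ℓ, wt_q(q^{m-1} + (q^{(m-4)/2} - 1)·i) = 1 + (q-1)ℓ; (3) for ℓ = (m-2)/2 and every 1 ≤ i ≤ q^{(m-4)/2}, wt_q(q^{m-1} + (q-1)·q^{m-2} + (q^{(m-4)/2} - 1)·i) = 1 + (q-1)ℓ; (4) for ℓ = m/2 and every 1 ≤ i ≤ q^{(m-4)/2}, wt_q(q^{m-1} + (q-1)·q^{m-2} + (q-1)·q^{m-3} + (q^{(m-4)/2} - 1)·i) = 1 + (q-1)ℓ; (5) for ℓ = (m+2)/2 and every 1 ≤ i ≤ q^{(m-4)/2}, wt_q(2q^{m-1} - 1 - (q^{(m-4)/2} - 1)·i) = 1 + (q-1)ℓ; (6) for every (m+4)/2 ≤ ℓ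 ≤ m - 1 and every 0 ≤ i ≤ (q-1)·q^{m-1-ℓ} - 1, wt_q(q^m - (q-1)·q^{m-1-ℓ} - (q^{(m+4)/2} - 1)·i) = 1 + (q-1)ℓ. In particular all these integers lie in T_{(q,m,ℓ)}. -/
/-- The `q`-weight of a natural number: the sum of its base-`q` digits. -/
def wtq (q i : ℕ) : ℕ := (Nat.digits q i).sum

/-- Prepending a least significant digit adds it to the `q`-weight. -/
theorem wtq_add_mul {q r : ℕ} (hq : 1 < q) (hr : r < q) (n : ℕ) :
    wtq q (r + q * n) = r + wtq q n := by
  unfold wtq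
  rcases Nat.eq_zero_or_pos (r + q * n) with h | h
  · have h1 : r = 0 := by omega
    have h2 : n = 0 := by
      rcases Nat.mul_eq_zero.1 (show q * n = 0 by omega) with h | h <;> omega
    simp [h1, h2]
  · have h0 : r ≠ 0 ∨ n ≠ 0 := by
      by_contra! hc
      simp [hc.1, hc.2] at h
    rw [Nat.digits_add q hq r n hr h0, List.sum_cons]

theorem wtq_of_lt {q c : ℕ} (hq : 1 < q) (hc : c < q) : wtq q c = c := by
  simpa [wtq] using wtq_add_mul hq hc 0

/-- The `q`-weight is additive over concatenation of digit blocks. -/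
theorem wtq_add_pow_mul {q : ℕ} (hq : 1 < q) (k a b : ℕ) (ha : a < q ^ k) :
    wtq q (a + q ^ k * b) = wtq q a + wtq q b := by
  induction k generalizing a with
  | zero =>
    obtain rfl : a = 0 := by simpa using ha
    simp [wtq]
  | succ k ih =>
    have hr : a % q < q := Nat.mod_lt _ (by omega)
    have hd : a / q < q ^ k := Nat.div_lt_of_lt_mul (by rwa [← pow_succ'])
    have hsplit : a + q ^ (k + 1) * b = a % q + q * (a / q + q ^ k * b) := by
      conv_lhs => rw [← Nat.mod_add_div a q]
      ring
    rw [hsplit, wtq_add_mul hq hr, ih _ hd, ← add_assoc, ← wtq_add_mul hq hr,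
      Nat.mod_add_div]

/-- Complementing all `k` digits complements the `q`-weight. -/
theorem wtq_add_wtq_of_add_eq_pow {q : ℕ} (hq : 1 < q) (k a b : ℕ) (h : a + b + 1 = q ^ k) :
    wtq q a + wtq q b = (q - 1) * k := by
  induction k generalizing a b with
  | zero =>
    obtain ⟨rfl, rfl⟩ : a = 0 ∧ b = 0 := by
      rw [pow_zero] at h
      omega
    simp [wtq]
  | succ k ih =>
    have hr : a % q < q := Nat.mod_lt _ (by omega)
    have hda : a / q < q ^ k := Nat.div_lt_of_lt_mul (by rw [← pow_succ']; omega)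
    obtain ⟨d, hd⟩ : ∃ d, a / q + d + 1 = q ^ k := ⟨q ^ k - 1 - a / q, by omega⟩
    have hb : b = (q - 1 - a % q) + q * d := by
      have h1 : q ^ (k + 1) = q * (a / q) + q * d + q := by
        rw [pow_succ', ← hd]
        ring
      have h2 := Nat.mod_add_div a q
      omega
    have hwa := wtq_add_mul hq hr (a / q)
    rw [Nat.mod_add_div] at hwa
    rw [hwa, hb, wtq_add_mul hq (by omega), mul_add, ← ih _ _ hd]
    omega

/-- Complementing with respect to `c * q ^ k - 1`, whose digits are `c - 1` followed by `k` digits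
`q - 1`. -/
theorem wtq_add_wtq_of_add_eq_mul_pow {q c : ℕ} (hq : 1 < q) (hc : c ≤ q) (k a b : ℕ)
    (h : a + b + 1 = c * q ^ k) : wtq q a + wtq q b = (c - 1) + (q - 1) * k := by
  have hpos : 0 < q ^ k := Nat.pow_pos (by omega)
  have hd : a / q ^ k < c := Nat.div_lt_of_lt_mul (by rw [mul_comm]; omega)
  obtain ⟨e, r, hr, he, rfl⟩ : ∃ e r, r < q ^ k ∧ e < c ∧ a = r + q ^ k * e :=
    ⟨a / q ^ k, a % q ^ k, Nat.mod_lt _ hpos, hd, (Nat.mod_add_div a (q ^ k)).symm⟩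
  obtain ⟨d, rfl⟩ : ∃ d, c = e + d + 1 := ⟨c - 1 - e, by omega⟩
  obtain ⟨t, ht⟩ : ∃ t, r + t + 1 = q ^ k := ⟨q ^ k - 1 - r, by omega⟩
  have hb : b = t + q ^ k * d := by
    have h1 : (e + d + 1) * q ^ k = q ^ k * e + q ^ k * d + q ^ k := by ring
    omega
  have hcompl := wtq_add_wtq_of_add_eq_pow hq k r t ht
  rw [hb, wtq_add_pow_mul hq k _ _ hr, wtq_add_pow_mul hq k _ _ (by omega),
    wtq_of_lt (c := e) hq (by omega), wtq_of_lt (c := d) hq (by omega)]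
  omega

theorem wtq_pow_sub_one_mul {q : ℕ} (hq : 1 < q) (k i : ℕ) (h1 : 1 ≤ i) (hi : i ≤ q ^ k) :
    wtq q ((q ^ k - 1) * i) = (q - 1) * k := by
  obtain ⟨j, rfl⟩ : ∃ j, i = j + 1 := ⟨i - 1, by omega⟩
  obtain ⟨t, ht⟩ : ∃ t, q ^ k = t + j + 1 := ⟨q ^ k - 1 - j, by omega⟩
  have hsplit : (q ^ k - 1) * (j + 1) = t + q ^ k * j := by
    rw [ht, Nat.add_sub_cancel]
    ring
  rw [hsplit, wtq_add_pow_mul hq k _ _ (by omega)]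
  exact wtq_add_wtq_of_add_eq_pow hq k _ _ ht.symm

theorem pow_sub_one_mul_lt_pow {q k n i : ℕ} (hq : 0 < q) (hi : i ≤ q ^ k) (hn : 2 * k ≤ n) :
    (q ^ k - 1) * i < q ^ n := by
  have hpos : 0 < q ^ k := Nat.pow_pos hq
  calc (q ^ k - 1) * i ≤ (q ^ k - 1) * q ^ k := Nat.mul_le_mul_left _ hi
    _ < q ^ k * q ^ k := Nat.mul_lt_mul_of_pos_right (by omega) hpos
    _ = q ^ (2 * k) := by ring
    _ ≤ q ^ n := Nat.pow_le_pow_right hq hn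

/-- Let `q ≥ 3` be a prime power and `m ≥ 6` with `m ≡ 2 (mod 4)`. Then:
(1) for `0 ≤ ℓ ≤ (m-6)/2` and `0 ≤ i ≤ 2q^ℓ - 1`,
    `wt_q(2q^ℓ - 1 + (q^{(m+4)/2} - 1)·i) = 1 + (q-1)ℓ`;
(2) for `ℓ = (m-4)/2` and `1 ≤ i ≤ q^ℓ`,
    `wt_q(q^{m-1} + (q^{(m-4)/2} - 1)·i) = 1 + (q-1)ℓ`;
(3) for `ℓ = (m-2)/2` and `1 ≤ i ≤ q^{(m-4)/2}`,
    `wt_q(q^{m-1} + (q-1)q^{m-2} + (q^{(m-4)/2} - 1)·i) = 1 + (q-1)ℓ`;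
(4) for `ℓ = m/2` and `1 ≤ i ≤ q^{(m-4)/2}`,
    `wt_q(q^{m-1} + (q-1)q^{m-2} + (q-1)q^{m-3} + (q^{(m-4)/2} - 1)·i) = 1 + (q-1)ℓ`;
(5) for `ℓ = (m+2)/2` and `1 ≤ i ≤ q^{(m-4)/2}`,
    `wt_q(2q^{m-1} - 1 - (q^{(m-4)/2} - 1)·i) = 1 + (q-1)ℓ`;
(6) for `(m+4)/2 ≤ ℓ ≤ m - 1` and `0 ≤ i ≤ (q-1)q^{m-1-ℓ} - 1`,
    `wt_q(q^m - (q-1)q^{m-1-ℓ} - (q^{(m+4)/2} - 1)·i) = 1 + (q-1)ℓ`.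
In particular all these integers lie in `T_{(q,m,ℓ)}`. -/
theorem stmt15 (q m : ℕ) (hq : 3 ≤ q) (hpp : IsPrimePow q)
    (hm : 6 ≤ m) (hm4 : m % 4 = 2) :
    (∀ l i : ℕ, l ≤ (m - 6) / 2 → i ≤ 2 * q ^ l - 1 →
      wtq q (2 * q ^ l - 1 + (q ^ ((m + 4) / 2) - 1) * i) = 1 + (q - 1) * l) ∧
    (∀ i : ℕ, 1 ≤ i → i ≤ q ^ ((m - 4) / 2) →
      wtq q (q ^ (m - 1) + (q ^ ((m - 4) / 2) - 1) * i)
        = 1 + (q - 1) * ((m - 4) / 2)) ∧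
    (∀ i : ℕ, 1 ≤ i → i ≤ q ^ ((m - 4) / 2) →
      wtq q (q ^ (m - 1) + (q - 1) * q ^ (m - 2) + (q ^ ((m - 4) / 2) - 1) * i)
        = 1 + (q - 1) * ((m - 2) / 2)) ∧
    (∀ i : ℕ, 1 ≤ i → i ≤ q ^ ((m - 4) / 2) →
      wtq q (q ^ (m - 1) + (q - 1) * q ^ (m - 2) + (q - 1) * q ^ (m - 3)
          + (q ^ ((m - 4) / 2) - 1) * i)
        = 1 + (q - 1) * (m / 2)) ∧
    (∀ i : ℕ, 1 ≤ i → i ≤ q ^ ((m - 4) / 2) →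
      wtq q (2 * q ^ (m - 1) - 1 - (q ^ ((m - 4) / 2) - 1) * i)
        = 1 + (q - 1) * ((m + 2) / 2)) ∧
    (∀ l i : ℕ, (m + 4) / 2 ≤ l → l ≤ m - 1 → i ≤ (q - 1) * q ^ (m - 1 - l) - 1 →
      wtq q (q ^ m - (q - 1) * q ^ (m - 1 - l) - (q ^ ((m + 4) / 2) - 1) * i)
        = 1 + (q - 1) * l) := by
  clear hpp
  have hq1 : 1 < q := by omega
  have hq0 : 0 < q := by omega
  obtain ⟨h, rfl⟩ : ∃ h, m = 2 * h + 4 := ⟨(m - 4) / 2, by omega⟩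
  rw [show (2 * h + 4 - 6) / 2 = h - 1 by omega, show (2 * h + 4 + 4) / 2 = h + 4 by omega,
    show (2 * h + 4 - 4) / 2 = h by omega, show (2 * h + 4 - 2) / 2 = h + 1 by omega,
    show (2 * h + 4) / 2 = h + 2 by omega, show (2 * h + 4 + 2) / 2 = h + 3 by omega,
    show 2 * h + 4 - 1 = 2 * h + 3 by omega, show 2 * h + 4 - 2 = 2 * h + 2 by omega,
    show 2 * h + 4 - 3 = 2 * h + 1 by omega]
  have hw1 : wtq q 1 = 1 := wtq_of_lt hq1 hq1
  have hwq : wtq q (q - 1) = q - 1 := wtq_of_lt hq1 (by omega)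
  have hlt : ∀ n i, i ≤ q ^ h → 2 * h ≤ n → (q ^ h - 1) * i < q ^ n :=
    fun n i hi hn => pow_sub_one_mul_lt_pow hq0 hi hn
  refine ⟨?_, ?_, ?_, ?_, ?_, ?_⟩
  · intro l i hl hi
    have hpos : 0 < q ^ l := Nat.pow_pos hq0
    have hle : 2 * q ^ l ≤ q ^ (h + 4) := calc
      2 * q ^ l ≤ q * q ^ l := Nat.mul_le_mul_right _ (by omega)
      _ = q ^ (l + 1) := (pow_succ' q l).symm
      _ ≤ q ^ (h + 4) := Nat.pow_le_pow_right hq0 (by omega)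
    obtain ⟨t, ht⟩ : ∃ t, t + i + 1 = 2 * q ^ l := ⟨2 * q ^ l - 1 - i, by omega⟩
    have hsplit : 2 * q ^ l - 1 + (q ^ (h + 4) - 1) * i = t + q ^ (h + 4) * i := by
      have hmul : i ≤ q ^ (h + 4) * i := Nat.le_mul_of_pos_left _ (Nat.pow_pos hq0)
      rw [Nat.sub_one_mul]
      omega
    rw [hsplit, wtq_add_pow_mul hq1 _ _ _ (by omega),
      wtq_add_wtq_of_add_eq_mul_pow hq1 (by omega) l _ _ ht]
  · intro i h1 hi
    rw [show q ^ (2 * h + 3) + (q ^ h - 1) * i = (q ^ h - 1) * i + q ^ (2 * h + 3) * 1 by ring,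
      wtq_add_pow_mul hq1 _ _ _ (hlt _ _ hi (by omega)), wtq_pow_sub_one_mul hq1 _ _ h1 hi, hw1]
    ring
  · intro i h1 hi
    rw [show q ^ (2 * h + 3) + (q - 1) * q ^ (2 * h + 2) + (q ^ h - 1) * i
        = (q ^ h - 1) * i + q ^ (2 * h + 2) * ((q - 1) + q * 1) by ring,
      wtq_add_pow_mul hq1 _ _ _ (hlt _ _ hi (by omega)), wtq_pow_sub_one_mul hq1 _ _ h1 hi,
      wtq_add_mul hq1 (by omega), hw1]
    ring
  · intro i h1 hi
    rw [show q ^ (2 * h + 3) + (q - 1) * q ^ (2 * h + 2) + (q - 1) * q ^ (2 * h + 1)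
          + (q ^ h - 1) * i
        = (q ^ h - 1) * i + q ^ (2 * h + 1) * ((q - 1) + q * ((q - 1) + q * 1)) by ring,
      wtq_add_pow_mul hq1 _ _ _ (hlt _ _ hi (by omega)), wtq_pow_sub_one_mul hq1 _ _ h1 hi,
      wtq_add_mul hq1 (by omega), wtq_add_mul hq1 (by omega), hw1]
    ring
  · intro i h1 hi
    have hX := hlt (2 * h + 3) i hi (by omega)
    have hwX := wtq_pow_sub_one_mul hq1 _ _ h1 hi
    have hsum := wtq_add_wtq_of_add_eq_mul_pow (c := 2) hq1 (by omega) (2 * h + 3)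
      (2 * q ^ (2 * h + 3) - 1 - (q ^ h - 1) * i) ((q ^ h - 1) * i) (by omega)
    rw [hwX, show (q - 1) * (2 * h + 3) = (q - 1) * (h + 3) + (q - 1) * h by ring] at hsum
    omega
  · intro l i hl hl' hi
    obtain ⟨s, hs⟩ : ∃ s, 2 * h + 3 = l + s := ⟨2 * h + 3 - l, by omega⟩
    rw [show 2 * h + 3 - l = s by omega] at hi ⊢
    have hc : 0 < (q - 1) * q ^ s := Nat.mul_pos (by omega) (Nat.pow_pos hq0)
    have hle : (q - 1) * q ^ s ≤ q ^ h := calc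
      (q - 1) * q ^ s ≤ q * q ^ s := Nat.mul_le_mul_right _ (by omega)
      _ = q ^ (s + 1) := (pow_succ' q s).symm
      _ ≤ q ^ h := Nat.pow_le_pow_right hq0 (by omega)
    have hle' : q ^ h ≤ q ^ (h + 4) := Nat.pow_le_pow_right hq0 (by omega)
    obtain ⟨t, ht⟩ : ∃ t, t + i + 1 = (q - 1) * q ^ s := ⟨(q - 1) * q ^ s - 1 - i, by omega⟩
    obtain ⟨u, hu⟩ : ∃ u, u + i + 1 = q ^ h := ⟨q ^ h - 1 - i, by omega⟩
    obtain ⟨v, hv⟩ : ∃ v, v + t + 1 = q ^ (h + 4) := ⟨q ^ (h + 4) - 1 - t, by omega⟩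
    have hsplit : q ^ (2 * h + 4) - (q - 1) * q ^ s - (q ^ (h + 4) - 1) * i
        = v + q ^ (h + 4) * u := by
      have hpow : q ^ (2 * h + 4)
          = q ^ (h + 4) * u + q ^ (h + 4) * i + q ^ (h + 4) := by
        rw [show 2 * h + 4 = (h + 4) + h by ring, pow_add, ← hu]
        ring
      have hmul : i ≤ q ^ (h + 4) * i := Nat.le_mul_of_pos_left _ (Nat.pow_pos hq0)
      rw [Nat.sub_one_mul (q ^ (h + 4))]
      omega
    rw [hsplit, wtq_add_pow_mul hq1 _ _ _ (by omega)]
    have hwt := wtq_add_wtq_of_add_eq_mul_pow hq1 (by omega) s _ _ ht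
    have hwu := wtq_add_wtq_of_add_eq_pow hq1 _ _ _ hu
    have hwv := wtq_add_wtq_of_add_eq_pow hq1 _ _ _ hv
    have htot : (q - 1) * h + (q - 1) * (h + 4) = (q - 1) * l + (q - 1) * s + (q - 1) := by
      rw [← mul_add, ← mul_add, show h + (h + 4) = l + s + 1 by omega, mul_add, mul_one]
    omega
end
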